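/- For all x ∈ G and all y, z ∈ G, the componentwise mixed composition product is a right action of the affine feedback group (G, ⋆) on the set G: (x ⊲ y) ⊲ z = x ⊲ (y ⋆ z), and x ⊲ e = x, where e = (𝟙, 0). -/

import Mathlib

open scoped Classical

/-!  Common setup: noncommutative formal power series ℝ⟨⟨X⟩⟩ over the
alphabet X = {x₀, x₁}.  Words are encoded as lists over `Fin 2`
(the letter `0` is x₀ and `1` is x₁); a series is a function from words
to ℝ, recording its coefficients. -/

/-- Words over the alphabet X = {x₀, x₁}. -/
abbrev Word : Type := List (Fin 2)

/-- Noncommutative formal power series ℝ⟨⟨X⟩⟩. -/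
abbrev Ser : Type := Word → ℝ

/-- The series 𝟙 (the empty word). -/
def one1 : Ser := fun w => if w = [] then 1 else 0

/-- A single word η regarded as a series. -/
def mono (η : Word) : Ser := fun w => if w = η then 1 else 0

/-- Left concatenation of a series by the letter `x_i`. -/
def lc (i : Fin 2) (c : Ser) : Ser := fun w =>
  match w with
  | [] => 0
  | j :: u => if j = i then c u else 0

/-- Auxiliary recursion computing the coefficient of a word `w` in `c ⧢ d`:
`(c ⧢ d)(𝟙) = c(𝟙) d(𝟙)` and
`(c ⧢ d)(x_i w) = ((x_i⁻¹ c) ⧢ d)(w) + (c ⧢ (x_i⁻¹ d))(w)`,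
where `x_i⁻¹` is the left shift.  This dual recursion is exactly the
bilinear extension of the inductive shuffle of words
`(x_i ξ) ⧢ (x_j η) = x_i (ξ ⧢ x_j η) + x_j (x_i ξ ⧢ η)`, `𝟙 ⧢ η = η ⧢ 𝟙 = η`. -/
def shAux : Word → Ser → Ser → ℝ
  | [], c, d => c [] * d []
  | i :: w, c, d => shAux w (fun u => c (i :: u)) d + shAux w c (fun u => d (i :: u))

/-- The shuffle product `⧢` on ℝ⟨⟨X⟩⟩. -/
def sh (c d : Ser) : Ser := fun w => shAux w c d

/-- Shuffle powers `c^{⧢ k}`. -/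
def shPow (c : Ser) : ℕ → Ser
  | 0 => one1
  | k + 1 => sh c (shPow c k)

/-- The shuffle inverse `c^{⧢ -1} = Σ_{k ≥ 0} (𝟙 - c)^{⧢ k}`.
When `c(𝟙) = 1` the sum is locally finite (for each word only finitely many
terms are nonzero) and `∑'` returns it. -/
noncomputable def shInv (c : Ser) : Ser := fun w => ∑' k : ℕ, shPow (one1 - c) k w

/-- Composition product restricted to words: `𝟙 ∘ d = 𝟙`,
`(x₀ η) ∘ d = x₀ (η ∘ d)`, `(x₁ η) ∘ d = x₀ (d ⧢ (η ∘ d))`. -/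
def wordComp : Word → Ser → Ser
  | [], _ => one1
  | i :: η, d => if i = 0 then lc 0 (wordComp η d) else lc 0 (sh d (wordComp η d))

/-- The composition product `c ∘ d = Σ_η c(η) (η ∘ d)`.  For each fixed word
only finitely many terms are nonzero, and `∑'` returns the sum. -/
noncomputable def comp (c d : Ser) : Ser := fun w => ∑' η : Word, c η * wordComp η d w

/-- Membership in the set `G`: pairs `(d₁, d₂)` with `d₁(𝟙) = 1`. -/
def inG (d : Ser × Ser) : Prop := d.1 [] = 1

/-- Mixed composition product restricted to words: `𝟙 ◁ d = 𝟙`,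
`(x₀ η) ◁ d = x₀ (η ◁ d)`,
`(x₁ η) ◁ d = x₁ (d₁ ⧢ (η ◁ d)) + x₀ (d₂ ⧢ (η ◁ d))`. -/
def wordMComp : Word → Ser × Ser → Ser
  | [], _ => one1
  | i :: η, d =>
      if i = 0 then lc 0 (wordMComp η d)
      else lc 1 (sh d.1 (wordMComp η d)) + lc 0 (sh d.2 (wordMComp η d))

/-- The mixed composition product `c ◁ d = Σ_η c(η) (η ◁ d)`. -/
noncomputable def mcomp (c : Ser) (d : Ser × Ser) : Ser :=
  fun w => ∑' η : Word, c η * wordMComp η d w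

/-- Componentwise mixed composition `c ⊲ d = (c₁ ◁ d, c₂ ◁ d)`. -/
noncomputable def tri (c d : Ser × Ser) : Ser × Ser := (mcomp c.1 d, mcomp c.2 d)

/-- Componentwise composition `d ∘̄ c = (d₁ ∘ c, d₂ ∘ c)`. -/
noncomputable def bcomp (d : Ser × Ser) (c : Ser) : Ser × Ser := (comp d.1 c, comp d.2 c)

/-- The group product `⊙` on `G`:
`(c₁, c₂) ⊙ (d₁, d₂) = (c₁ ⧢ d₁, c₂ + d₂ ⧢ c₁)`. -/
def odot (c d : Ser × Ser) : Ser × Ser := (sh c.1 d.1, c.2 + sh d.2 c.1)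

/-- The identity element `e = (𝟙, 0)`. -/
def eG : Ser × Ser := (one1, 0)

/-- The `⊙`-inverse `c^{⊙ -1} = (c₁^{⧢ -1}, -(c₁^{⧢ -1} ⧢ c₂))`. -/
noncomputable def odotInv (c : Ser × Ser) : Ser × Ser :=
  (shInv c.1, -(sh (shInv c.1) c.2))

/-- The affine feedback group product `c ⋆ d = (c ⊲ d) ⊙ d` on `G`. -/
noncomputable def star (c d : Ser × Ser) : Ser × Ser := odot (tri c d) d

/-- The `⋆`-inverse of an element of `G` (defined via choice; for an element
of the group `(G, ⋆)` it is the unique two-sided `⋆`-inverse). -/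
noncomputable def starInv (x : Ser × Ser) : Ser × Ser :=
  if h : ∃ y : Ser × Ser, inG y ∧ star x y = eG ∧ star y x = eG then h.choose else x

/-- The affine feedback product `c @ d = c ◁ ((d^{⊙ -1}) ∘̄ c)^{⋆ -1}`. -/
noncomputable def atp (c : Ser) (d : Ser × Ser) : Ser :=
  mcomp c (starInv (bcomp (odotInv d) c))

/-- Membership in ℝ[[x₀]]: series vanishing on every word containing x₁. -/
def inRx0 (c : Ser) : Prop := ∀ w : Word, (1 : Fin 2) ∈ w → c w = 0

/-- Left shift of a series by the letter `x_i`. -/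
def leftShift (i : Fin 2) (c : Ser) : Ser := fun u => c (i :: u)

lemma sh_nil (c d : Ser) : sh c d [] = c [] * d [] := rfl

lemma leftShift_sh (i : Fin 2) (c d : Ser) :
    leftShift i (sh c d) = sh (leftShift i c) d + sh c (leftShift i d) := rfl

lemma leftShift_add (i : Fin 2) (c d : Ser) :
    leftShift i (c + d) = leftShift i c + leftShift i d := rfl

lemma sh_cons (c d : Ser) (i : Fin 2) (w : Word) :
    sh c d (i :: w) = sh (leftShift i c) d w + sh c (leftShift i d) w := rfl

lemma sh_comm (c d : Ser) : sh c d = sh d c := by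
  funext w
  induction w generalizing c d with
  | nil => exact mul_comm _ _
  | cons i w ih => rw [sh_cons, sh_cons, ih, ih c, add_comm]

lemma sh_add (c d e : Ser) : sh c (d + e) = sh c d + sh c e := by
  funext w
  induction w generalizing c d e with
  | nil => exact mul_add _ _ _
  | cons i w ih =>
    simp only [Pi.add_apply, sh_cons, leftShift_add] at ih ⊢
    rw [ih, ih]
    ring

lemma add_sh (c d e : Ser) : sh (c + d) e = sh c e + sh d e := by
  rw [sh_comm, sh_add, sh_comm e c, sh_comm e d]

lemma sh_smul (r : ℝ) (c d : Ser) : sh c (r • d) = r • sh c d := by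
  funext w
  induction w generalizing c d with
  | nil => exact mul_left_comm _ _ _
  | cons i w ih =>
    have e : leftShift i (r • d) = r • leftShift i d := rfl
    simp only [Pi.smul_apply, sh_cons, e] at ih ⊢
    rw [ih, ih, smul_add]

lemma sh_assoc (c d e : Ser) : sh (sh c d) e = sh c (sh d e) := by
  funext w
  induction w generalizing c d e with
  | nil => exact mul_assoc _ _ _
  | cons i w ih =>
    simp only [sh_cons, leftShift_sh, sh_add, add_sh, Pi.add_apply, ih]
    ring

lemma zero_sh (c : Ser) : sh 0 c = 0 := by
  simpa using add_sh 0 0 c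

lemma leftShift_one1 (i : Fin 2) : leftShift i one1 = 0 := by
  funext w
  simp [leftShift, one1]

lemma one1_sh (c : Ser) : sh one1 c = c := by
  funext w
  induction w generalizing c with
  | nil => simp [sh_nil, one1]
  | cons i w ih => rw [sh_cons, leftShift_one1, zero_sh, ih]; simp [leftShift]

lemma continuous_sh_right (c : Ser) : Continuous (sh c) := by
  refine continuous_pi fun w => ?_
  induction w generalizing c with
  | nil => exact continuous_const.mul (continuous_apply _)
  | cons i w ih =>
    have hs : Continuous (leftShift i) := continuous_pi fun u => continuous_apply (i :: u)
    exact (ih (leftShift i c)).add ((ih c).comp hs)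

/-- Shuffling with a fixed series on the left, as a continuous linear map for the topology of
coefficientwise convergence. -/
def shL (c : Ser) : Ser →L[ℝ] Ser where
  toFun := sh c
  map_add' := sh_add c
  map_smul' r d := sh_smul r c d
  cont := continuous_sh_right c

/-- Left concatenation by a letter, as a continuous linear map. -/
def lcL (i : Fin 2) : Ser →L[ℝ] Ser where
  toFun := lc i
  map_add' c d := by
    funext w
    cases w with
    | nil => simp [lc]
    | cons j u => simp only [lc, Pi.add_apply]; split_ifs <;> simp
  map_smul' r d := by
    funext w
    cases w with
    | nil => simp [lc]
    | cons j u => simp only [lc, Pi.smul_apply, RingHom.id_apply]; split_ifs <;> simp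
  cont := by
    refine continuous_pi fun w => ?_
    cases w with
    | nil => exact continuous_const
    | cons j u =>
      simp only [lc]
      split_ifs
      · exact continuous_apply u
      · exact continuous_const

/-- The coefficients of two series agree on all words of length at most `n`. -/
def EqUpTo (n : ℕ) (c d : Ser) : Prop := ∀ w : Word, w.length ≤ n → c w = d w

lemma EqUpTo.add {n : ℕ} {a b c d : Ser} (h : EqUpTo n a b) (h' : EqUpTo n c d) :
    EqUpTo n (a + c) (b + d) := fun w hw => by
  rw [Pi.add_apply, Pi.add_apply, h w hw, h' w hw]

lemma EqUpTo.sh_left {n : ℕ} (c : Ser) {a b : Ser} (h : EqUpTo n a b) :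
    EqUpTo n (sh c a) (sh c b) := by
  intro w hw
  induction w generalizing n c a b with
  | nil => rw [sh_nil, sh_nil, h [] hw]
  | cons i w ih =>
    have hw' : w.length + 1 ≤ n := hw
    rw [sh_cons, sh_cons, ih _ h (by omega),
      ih (n := w.length) (a := leftShift i a) (b := leftShift i b) c (fun u hu =>
        h (i :: u) (by simp only [List.length_cons]; omega)) le_rfl]

lemma EqUpTo.succ {n : ℕ} {c d : Ser} (h : c [] = d [])
    (h' : ∀ i, EqUpTo n (leftShift i c) (leftShift i d)) : EqUpTo (n + 1) c d := by
  intro w hw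
  cases w with
  | nil => exact h
  | cons i w => exact h' i w (by simpa using hw)

lemma eq_of_forall_eqUpTo {c d : Ser} (h : ∀ n, EqUpTo n c d) : c = d :=
  funext fun w => h w.length w le_rfl

lemma sh_apply_eq_zero {n : ℕ} (c : Ser) {d : Ser} (h : ∀ w : Word, w.length ≤ n → d w = 0)
    {w : Word} (hw : w.length ≤ n) : sh c d w = 0 := by
  rw [EqUpTo.sh_left c (b := 0) h w hw]
  exact congrFun (map_zero (shL c)) w

lemma wordMComp_apply_eq_zero (d : Ser × Ser) (η w : Word) (h : w.length < η.length) :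
    wordMComp η d w = 0 := by
  induction η generalizing w with
  | nil => simp at h
  | cons i η ih =>
    cases w with
    | nil => simp only [wordMComp]; split_ifs <;> simp [lc]
    | cons j u =>
      have hu : u.length < η.length := by simpa using h
      have key : ∀ c, sh c (wordMComp η d) u = 0 := fun c =>
        sh_apply_eq_zero c (n := u.length) (fun v hv => ih v (by omega)) le_rfl
      simp only [wordMComp]
      split_ifs <;> simp [lc, ih u hu, key]

lemma hasSum_mcomp (c : Ser) (d : Ser × Ser) :
    HasSum (fun η => c η • wordMComp η d) (mcomp c d) := by
  refine Pi.hasSum.2 fun w => ?_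
  refine (summable_of_hasFiniteSupport ?_ : Summable fun η => c η * wordMComp η d w).hasSum
  refine (List.finite_length_le (Fin 2) w.length).subset fun η hη => ?_
  by_contra hlen
  exact hη (by simp [wordMComp_apply_eq_zero d η w (by simpa using hlen)])

lemma mcomp_add (a b : Ser) (d : Ser × Ser) : mcomp (a + b) d = mcomp a d + mcomp b d := by
  refine (hasSum_mcomp (a + b) d).unique ?_
  simpa [add_smul] using (hasSum_mcomp a d).add (hasSum_mcomp b d)

/-- A sum over words splits according to the first letter. -/
lemma hasSum_word {f : Word → Ser} {a b : Ser} (h0 : HasSum (fun η => f (0 :: η)) a)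
    (h1 : HasSum (fun η => f (1 :: η)) b) : HasSum f (f [] + a + b) := by
  have hinj : ∀ i : Fin 2, Function.Injective (fun η : Word => i :: η) :=
    fun i => List.cons_injective
  have e0 := (hasSum_extend_zero (hinj 0)).2 h0
  have e1 := (hasSum_extend_zero (hinj 1)).2 h1
  convert ((hasSum_ite_eq ([] : Word) (f [])).add e0).add e1 using 1
  funext η
  cases η with
  | nil => rw [Function.extend_apply', Function.extend_apply'] <;> simp
  | cons i η =>
    have hne : ∀ j, j ≠ i → Function.extend (fun η : Word => j :: η) (fun η => f (j :: η)) 0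
        (i :: η) = 0 := fun j hj => by
      rw [Function.extend_apply'] <;> simp [hj]
    have heq := (hinj i).extend_apply (fun η => f (i :: η)) 0 η
    obtain rfl | rfl : i = 0 ∨ i = 1 := by fin_cases i <;> simp
    · rw [heq, hne 1 (by decide)]
      simp
    · rw [heq, hne 0 (by decide)]
      simp

lemma mcomp_eq (c : Ser) (d : Ser × Ser) :
    mcomp c d = c [] • one1 + lc 0 (mcomp (leftShift 0 c) d) +
      (lc 1 (sh d.1 (mcomp (leftShift 1 c) d)) + lc 0 (sh d.2 (mcomp (leftShift 1 c) d))) := by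
  have h0 := (hasSum_mcomp (leftShift 0 c) d).mapL (lcL 0)
  have h1 := (hasSum_mcomp (leftShift 1 c) d).mapL
    ((lcL 1).comp (shL d.1) + (lcL 0).comp (shL d.2))
  refine (hasSum_mcomp c d).unique
    (hasSum_word (f := fun η => c η • wordMComp η d) (h0.congr_fun ?_) (h1.congr_fun ?_))
  · intro η
    rw [map_smul]
    rfl
  · intro η
    rw [map_smul]
    rfl

lemma mcomp_nil (c : Ser) (d : Ser × Ser) : mcomp c d [] = c [] := by
  rw [mcomp_eq]
  simp [one1, lc]

lemma leftShift_zero_mcomp (c : Ser) (d : Ser × Ser) :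
    leftShift 0 (mcomp c d) =
      mcomp (leftShift 0 c) d + sh d.2 (mcomp (leftShift 1 c) d) := by
  funext w
  rw [leftShift, mcomp_eq]
  simp [one1, lc]

lemma leftShift_one_mcomp (c : Ser) (d : Ser × Ser) :
    leftShift 1 (mcomp c d) = sh d.1 (mcomp (leftShift 1 c) d) := by
  funext w
  rw [leftShift, mcomp_eq]
  simp [one1, lc]

lemma mcomp_sh (a b : Ser) (d : Ser × Ser) :
    mcomp (sh a b) d = sh (mcomp a d) (mcomp b d) := by
  refine eq_of_forall_eqUpTo fun n => ?_
  have hnil : ∀ a b, mcomp (sh a b) d [] = sh (mcomp a d) (mcomp b d) [] := fun a b => by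
    simp only [mcomp_nil, sh_nil]
  induction n generalizing a b with
  | zero =>
    intro w hw
    obtain rfl : w = [] := List.length_eq_zero_iff.1 (by omega)
    exact hnil a b
  | succ n ih =>
    have key : ∀ i, EqUpTo n (mcomp (leftShift i (sh a b)) d)
        (sh (mcomp (leftShift i a) d) (mcomp b d) +
          sh (mcomp a d) (mcomp (leftShift i b) d)) := fun i => by
      rw [leftShift_sh, mcomp_add]
      exact (ih _ _).add (ih _ _)
    refine EqUpTo.succ (hnil a b) (Fin.forall_fin_two.2 ⟨?_, ?_⟩)
    · rw [leftShift_zero_mcomp, leftShift_sh _ (mcomp a d), leftShift_zero_mcomp, leftShift_zero_mcomp]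
      convert (key 0).add ((key 1).sh_left d.2) using 1
      rw [add_sh, sh_add, sh_add, sh_assoc, ← sh_assoc (mcomp a d), sh_comm (mcomp a d) d.2,
        sh_assoc]
      abel
    · rw [leftShift_one_mcomp, leftShift_sh _ (mcomp a d), leftShift_one_mcomp, leftShift_one_mcomp]
      convert (key 1).sh_left d.1 using 1
      rw [sh_add, sh_assoc, ← sh_assoc (mcomp a d), sh_comm (mcomp a d) d.1, sh_assoc]

lemma mcomp_mcomp (c : Ser) (y z : Ser × Ser) :
    mcomp (mcomp c y) z = mcomp c (odot (tri y z) z) := by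
  refine eq_of_forall_eqUpTo fun n => ?_
  have hnil : ∀ c, mcomp (mcomp c y) z [] = mcomp c (odot (tri y z) z) [] := fun c => by
    simp only [mcomp_nil]
  induction n generalizing c with
  | zero =>
    intro w hw
    obtain rfl : w = [] := List.length_eq_zero_iff.1 (by omega)
    exact hnil c
  | succ n ih =>
    refine EqUpTo.succ (hnil c) (Fin.forall_fin_two.2 ⟨?_, ?_⟩)
    · rw [leftShift_zero_mcomp, leftShift_zero_mcomp, leftShift_zero_mcomp, leftShift_one_mcomp,
        mcomp_add, mcomp_sh, mcomp_sh, ← sh_assoc, add_assoc, ← add_sh]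
      exact (ih _).add ((ih _).sh_left _)
    · rw [leftShift_one_mcomp, leftShift_one_mcomp, leftShift_one_mcomp, mcomp_sh, ← sh_assoc,
        sh_comm z.1]
      exact (ih _).sh_left _

lemma mcomp_eG (c : Ser) : mcomp c eG = c := by
  funext w
  induction w generalizing c with
  | nil => exact mcomp_nil c eG
  | cons i w ih =>
    have h : leftShift i (mcomp c eG) = mcomp (leftShift i c) eG := by
      fin_cases i
      · simpa [eG, zero_sh] using leftShift_zero_mcomp c eG
      · simpa [eG, one1_sh] using leftShift_one_mcomp c eG
    exact (congrFun h w).trans (ih _)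

/-- the componentwise mixed composition product is a right
action of the affine feedback group `(G, ⋆)` on the set `G`:
`(x ⊲ y) ⊲ z = x ⊲ (y ⋆ z)` and `x ⊲ e = x`. -/
theorem tri_right_action (x y z : Ser × Ser)
    (hx : inG x) (hy : inG y) (hz : inG z) :
    tri (tri x y) z = tri x (star y z) ∧ tri x eG = x :=
  ⟨Prod.ext (mcomp_mcomp x.1 y z) (mcomp_mcomp x.2 y z),
    Prod.ext (mcomp_eG x.1) (mcomp_eG x.2)⟩
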